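/- arXiv:1702.01696 — 10 statements merged into one kernel-verified Lean document; each statement's English description precedes it below -/
import Mathlib

section
/- Let Ψ : (0,∞) → ℝ be a non-increasing function satisfying exp(−τ) ≤ Ψ(τ) ≤ 1 for all τ > 0, and suppose that Ψ(τ/k) = Ψ(τ)^{1/k} for every τ > 0 and every positive integer k. Then there exists a constant θ ∈ [0,1] such that Ψ(τ) = exp(−θ·τ) for all τ > 0. -/
open Real

/-- A nonnegative monotone function on `(0, ∞)` that is homogeneous under multiplication by
positive integers is linear. -/
theorem eq_mul_of_monotone_of_natCast_mul {g : ℝ → ℝ}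
    (hmono : ∀ x y : ℝ, 0 < x → x ≤ y → g x ≤ g y) (hnonneg : ∀ x : ℝ, 0 < x → 0 ≤ g x)
    (hmul : ∀ x : ℝ, 0 < x → ∀ n : ℕ, 0 < n → g (n * x) = n * g x) {x : ℝ} (hx : 0 < x) :
    g x = g 1 * x := by
  have h1 : 0 ≤ g 1 := hnonneg 1 one_pos
  have hint : ∀ n : ℕ, 0 < n → g n = n * g 1 := fun n hn => by
    simpa using hmul 1 one_pos n hn
  have key : ∀ n : ℕ, n * |g x - g 1 * x| ≤ g 1 := by
    intro n
    rcases Nat.eq_zero_or_pos n with rfl | hn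
    · simpa using h1
    have hnx : 0 < (n : ℝ) * x := by positivity
    have hfloor := Nat.floor_le hnx.le
    have hceil := Nat.lt_floor_add_one ((n : ℝ) * x)
    have hnat := hmul x hx n hn
    have upper : g (n * x) ≤ (⌊(n : ℝ) * x⌋₊ + 1) * g 1 := by
      have h := hmono _ _ hnx hceil.le
      have h' := hint (⌊(n : ℝ) * x⌋₊ + 1) (Nat.succ_pos _)
      push_cast at h'
      rwa [h'] at h
    have lower : ⌊(n : ℝ) * x⌋₊ * g 1 ≤ g (n * x) := by
      rcases Nat.eq_zero_or_pos ⌊(n : ℝ) * x⌋₊ with h0 | hpos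
      · simpa [h0] using hnonneg _ hnx
      · rw [← hint _ hpos]
        exact hmono _ _ (by exact_mod_cast hpos) hfloor
    have habs : (n : ℝ) * |g x - g 1 * x| = |n * (g x - g 1 * x)| := by
      rw [abs_mul, Nat.abs_cast]
    rw [habs, abs_le]
    constructor <;> nlinarith
  by_contra hne
  obtain ⟨n, hn⟩ := exists_nat_gt (g 1 / |g x - g 1 * x|)
  rw [div_lt_iff₀ (abs_pos.mpr (sub_ne_zero.mpr hne))] at hn
  exact (key n).not_gt hn

/-- If `Ψ : (0,∞) → ℝ` is non-increasing, satisfies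
`exp (−τ) ≤ Ψ τ ≤ 1` for all `τ > 0`, and `Ψ (τ/k) = Ψ(τ)^{1/k}` for every
`τ > 0` and every positive integer `k`, then `Ψ τ = exp (−θ τ)` for some
constant `θ ∈ [0,1]`. -/
theorem stmt0 (Ψ : ℝ → ℝ)
    (hmono : ∀ τ₁ τ₂ : ℝ, 0 < τ₁ → τ₁ ≤ τ₂ → Ψ τ₂ ≤ Ψ τ₁)
    (hlow : ∀ τ : ℝ, 0 < τ → Real.exp (-τ) ≤ Ψ τ)
    (hup : ∀ τ : ℝ, 0 < τ → Ψ τ ≤ 1)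
    (hfe : ∀ τ : ℝ, 0 < τ → ∀ k : ℕ, 0 < k → Ψ (τ / k) = (Ψ τ) ^ ((1 : ℝ) / k)) :
    ∃ θ : ℝ, θ ∈ Set.Icc (0 : ℝ) 1 ∧ ∀ τ : ℝ, 0 < τ → Ψ τ = Real.exp (-(θ * τ)) := by
  have hpos : ∀ τ : ℝ, 0 < τ → 0 < Ψ τ := fun τ hτ => (Real.exp_pos _).trans_le (hlow τ hτ)
  have hnonneg : ∀ τ : ℝ, 0 < τ → 0 ≤ -Real.log (Ψ τ) := fun τ hτ =>
    neg_nonneg.mpr (Real.log_nonpos (hpos τ hτ).le (hup τ hτ))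
  have hlin : ∀ τ : ℝ, 0 < τ → -Real.log (Ψ τ) = -Real.log (Ψ 1) * τ := by
    intro τ hτ
    refine eq_mul_of_monotone_of_natCast_mul (g := fun τ => -Real.log (Ψ τ)) ?_ hnonneg ?_ hτ
    · intro x y hx hxy
      exact neg_le_neg (Real.log_le_log (hpos y (hx.trans_le hxy)) (hmono x y hx hxy))
    · intro x hx n hn
      have hn' : (0 : ℝ) < n := by exact_mod_cast hn
      have h := hfe (n * x) (by positivity) n hn
      rw [mul_div_cancel_left₀ x hn'.ne'] at h
      simp only [h, Real.log_rpow (hpos (n * x) (by positivity))]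
      field_simp
  refine ⟨-Real.log (Ψ 1), ⟨hnonneg 1 one_pos, ?_⟩, fun τ hτ => ?_⟩
  · exact neg_le.mp ((Real.le_log_iff_exp_le (hpos 1 one_pos)).mpr (hlow 1 one_pos))
  · rw [← hlin τ hτ, neg_neg, Real.exp_log (hpos τ hτ)]
end

section
/- Let (Ω, 𝔄, P) be a probability space, d ≥ 2 an integer and D = {1,…,d}. For each n ∈ ℕ let A_{n,1},…,A_{n,d}, B_n, C_n be events with C_n ⊆ B_n ⊆ ⋂_{j∈D} A_{n,j} and P(B_n) > 0, and let (k_n) be a sequence of positive real numbers. Assume that, as n → ∞: (i) k_n·P(C_n) → c; (ii) k_n·P(B_n) → b and P(C_nᶜ | B_n) → β; (iii) P(B_n) → 0; and (iv) for every nonempty J ⊆ D, k_n·P(⋂_{j∈J} A_{n,j} | B_nᶜ) → Θ_J. Then k_n·P(⋃_{j∈D} A_{n,j}) → c + b·β + Σ_{∅≠J⊆D} (−1)^{|J|+1} Θ_J. -/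
open MeasureTheory Filter

/-- Splitting of the measure of a finite union along nested measurable sets `C ⊆ B ⊆ ⋃ j, A j`,
with inclusion-exclusion applied outside `B`. -/
theorem measureReal_iUnion_eq_add_sum_powerset {Ω ι : Type*} [MeasurableSpace Ω] [Fintype ι]
    (P : Measure Ω) [IsFiniteMeasure P] {A : ι → Set Ω} {B C : Set Ω}
    (hA : ∀ j, MeasurableSet (A j)) (hB : MeasurableSet B) (hC : MeasurableSet C)
    (hCB : C ⊆ B) (hBA : B ⊆ ⋃ j, A j) :
    P.real (⋃ j, A j) = P.real C + P.real (Cᶜ ∩ B) +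
      ∑ J ∈ Finset.univ.powerset.filter (fun J : Finset ι => J.Nonempty),
        (-1 : ℝ) ^ (J.card + 1) * P.real ((⋂ j ∈ J, A j) ∩ Bᶜ) := by
  have hBsplit : P.real C + P.real (Cᶜ ∩ B) = P.real B := by
    rw [← measureReal_inter_add_sdiff (μ := P) (s := B) hC, Set.inter_eq_right.2 hCB,
      Set.inter_comm, Set.sdiff_eq]
  have hUsplit : P.real B + P.real ((⋃ j, A j) ∩ Bᶜ) = P.real (⋃ j, A j) := by
    rw [← measureReal_inter_add_sdiff (μ := P) (s := ⋃ j, A j) hB, Set.inter_eq_right.2 hBA,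
      Set.sdiff_eq]
  have hie := measureReal_biUnion_eq_sum_powerset (μ := P.restrict Bᶜ) (t := Finset.univ)
    (s := A) (fun j _ => hA j)
  simp only [Finset.mem_univ, Set.iUnion_true, measureReal_restrict_apply' hB.compl] at hie
  rw [hBsplit, ← hUsplit, hie]

/-- Abstract limit form of Proposition 2: if `C n ⊆ B n ⊆ ⋂ j, A n j`,
`k n * P (C n) → c`, `k n * P (B n) → b`, `P ((C n)ᶜ | B n) → β`, `P (B n) → 0` and
`k n * P (⋂_{j ∈ J} A n j | (B n)ᶜ) → Θ J` for each nonempty `J ⊆ D`, then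
`k n * P (⋃ j, A n j) → c + b·β + Σ_{∅≠J⊆D} (−1)^{|J|+1} Θ J`. -/
theorem stmt1 {Ω : Type*} [MeasurableSpace Ω] (P : Measure Ω) [IsProbabilityMeasure P]
    (d : ℕ) (hd : 2 ≤ d)
    (A : ℕ → Fin d → Set Ω) (B C : ℕ → Set Ω)
    (hAmeas : ∀ n j, MeasurableSet (A n j))
    (hBmeas : ∀ n, MeasurableSet (B n)) (hCmeas : ∀ n, MeasurableSet (C n))
    (hCB : ∀ n, C n ⊆ B n) (hBA : ∀ n, B n ⊆ ⋂ j, A n j)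
    (hBpos : ∀ n, 0 < (P (B n)).toReal)
    (k : ℕ → ℝ) (hk : ∀ n, 0 < k n)
    (c b β : ℝ) (Θ : Finset (Fin d) → ℝ)
    (hc : Tendsto (fun n => k n * (P (C n)).toReal) atTop (nhds c))
    (hb : Tendsto (fun n => k n * (P (B n)).toReal) atTop (nhds b))
    (hβ : Tendsto (fun n => (P ((C n)ᶜ ∩ B n)).toReal / (P (B n)).toReal)
      atTop (nhds β))
    (hB0 : Tendsto (fun n => (P (B n)).toReal) atTop (nhds 0))
    (hΘ : ∀ J : Finset (Fin d), J.Nonempty →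
      Tendsto (fun n =>
        k n * ((P ((⋂ j ∈ J, A n j) ∩ (B n)ᶜ)).toReal / (P ((B n)ᶜ)).toReal))
        atTop (nhds (Θ J))) :
    Tendsto (fun n => k n * (P (⋃ j, A n j)).toReal) atTop
      (nhds (c + b * β +
        ∑ J ∈ Finset.univ.powerset.filter (fun J : Finset (Fin d) => J.Nonempty),
          (-1 : ℝ) ^ (J.card + 1) * Θ J)) := by
  have : Nonempty (Fin d) := ⟨⟨0, by omega⟩⟩
  have hBc : ∀ n, (P (B n)ᶜ).toReal = 1 - (P (B n)).toReal := fun n =>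
    probReal_compl_eq_one_sub (hBmeas n)
  have hBc1 : Tendsto (fun n => (P (B n)ᶜ).toReal) atTop (nhds 1) := by
    simpa [hBc] using hB0.const_sub 1
  have hΘ' : ∀ J : Finset (Fin d), J.Nonempty →
      Tendsto (fun n => k n * P.real ((⋂ j ∈ J, A n j) ∩ (B n)ᶜ)) atTop (nhds (Θ J)) := by
    intro J hJ
    have h := (hΘ J hJ).mul hBc1
    rw [mul_one] at h
    refine h.congr' ?_
    filter_upwards [hBc1.eventually_ne one_ne_zero] with n hn
    rw [mul_assoc, div_mul_cancel₀ _ hn, measureReal_def]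
  have hlim := (hc.add (hb.mul hβ)).add (tendsto_finsetSum
    (Finset.univ.powerset.filter (fun J : Finset (Fin d) => J.Nonempty))
    (fun J hJ => (hΘ' J (Finset.mem_filter.1 hJ).2).const_mul ((-1 : ℝ) ^ (J.card + 1))))
  refine hlim.congr fun n => ?_
  have hBU : B n ⊆ ⋃ j, A n j := (hBA n).trans Set.iInter_subset_iUnion
  have hsplit := measureReal_iUnion_eq_add_sum_powerset P (hAmeas n) (hBmeas n) (hCmeas n)
    (hCB n) hBU
  simp only [measureReal_def] at hsplit ⊢
  rw [hsplit, mul_add, mul_add, Finset.mul_sum, mul_assoc, mul_div_cancel₀ _ (hBpos n).ne']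
  congr 1
  exact Finset.sum_congr rfl fun J _ => mul_left_comm _ _ _
end

section
/- Let (Ω, 𝔄, P) be a probability space, d ≥ 2 an integer and D = {1,…,d}. For each n ∈ ℕ let A_{n,1},…,A_{n,d} be events and, for each j ∈ {1,…,d−1}, let B_{n,j}, C_{n,j} be events with C_{n,j} ⊆ B_{n,j} ⊆ ⋂_{i=j}^{d} A_{n,i} and P(B_{n,j}) > 0, and let (k_n) be a sequence of positive real numbers. Assume that, as n → ∞: (i) k_n·P(A_{n,j}) → a_j for each j ∈ D; (ii) k_n·P(C_{n,j}) → c_j for each j ≤ d−1; (iii) k_n·P(B_{n,j}) → b_j and P(C_{n,j}ᶜ | B_{n,j}) → β^{(1)}_j for each j ≤ d−1; (iv) P(B_{n,j}) → 0 for each j ≤ d−1; and (v) for each j ≤ d−1 and each nonempty J ⊆ {j+1,…,d}, k_n·P(A_{n,j} ∩ ⋂_{i∈J} A_{n,i} | B_{n,j}ᶜ) → β^{(2)}_{{j}∪J}. Then k_n·P(⋃_{j∈D} A_{n,j}) → Σ_{j=1}^{d} a_j − Σ_{j=1}^{d−1} c_j − Σ_{j=1}^{d−1} b_j·β^{(1)}_j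 − Σ_{j=1}^{d−1} Σ_{∅≠J⊆{j+1,…,d}} (−1)^{|J|+1} β^{(2)}_{{j}∪J}. -/
open MeasureTheory Filter

/-- The measure of a finite union, disassembled by peeling off the sets one at a time. -/
theorem measureReal_biUnion_Icc_eq_sum_sub {Ω : Type*} [MeasurableSpace Ω] (P : Measure Ω)
    [IsFiniteMeasure P] (A : ℕ → Set Ω) (hA : ∀ i, MeasurableSet (A i)) (d j : ℕ) :
    P.real (⋃ i ∈ Finset.Icc j d, A i) =
      ∑ i ∈ Finset.Icc j d, (P.real (A i) - P.real (A i ∩ ⋃ l ∈ Finset.Icc (i + 1) d, A l)) := by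
  induction h : d + 1 - j generalizing j with
  | zero => simp [Finset.Icc_eq_empty_of_lt (show d < j by omega)]
  | succ m ih =>
    have hU : MeasurableSet (⋃ i ∈ Finset.Icc (j + 1) d, A i) :=
      Finset.measurableSet_biUnion _ fun i _ => hA i
    rw [← Finset.insert_Icc_add_one_left_eq_Icc (show j ≤ d by omega),
      Finset.set_biUnion_insert, Finset.sum_insert (by simp), ← ih (j + 1) (by omega)]
    have := measureReal_union_add_inter (μ := P) (s := A j) hU
      (measure_ne_top _ _) (measure_ne_top _ _)
    linarith

/-- Inclusion-exclusion for the measure of `(S ∩ ⋃ i ∈ s, A i) ∩ T`. -/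
theorem measureReal_inter_biUnion_inter_eq_sum_powerset {Ω : Type*} [MeasurableSpace Ω]
    (P : Measure Ω) [IsFiniteMeasure P] (A : ℕ → Set Ω) (hA : ∀ i, MeasurableSet (A i))
    (S T : Set Ω) (s : Finset ℕ) :
    P.real ((S ∩ ⋃ i ∈ s, A i) ∩ T) =
      ∑ J ∈ s.powerset.filter (fun J : Finset ℕ => J.Nonempty),
        (-1 : ℝ) ^ (J.card + 1) * P.real ((S ∩ ⋂ i ∈ J, A i) ∩ T) := by
  have hU : MeasurableSet (⋃ i ∈ s, A i) := Finset.measurableSet_biUnion _ fun i _ => hA i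
  rw [Set.inter_right_comm, Set.inter_comm, ← measureReal_restrict_apply hU,
    measureReal_biUnion_eq_sum_powerset fun i _ => hA i]
  refine Finset.sum_congr rfl fun J _ => ?_
  rw [measureReal_restrict_apply (Finset.measurableSet_biInter _ fun i _ => hA i),
    Set.inter_right_comm, Set.inter_comm]

/-- Abstract limit form of Proposition 3(a): with
`C n j ⊆ B n j ⊆ ⋂_{i=j}^{d} A n i` for `j ∈ {1,…,d−1}`, and the indicated limits,
`k n * P (⋃_{j=1}^{d} A n j) → Σ_{j=1}^{d} a j − Σ_{j=1}^{d−1} c j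
 − Σ_{j=1}^{d−1} b j * β¹ j − Σ_{j=1}^{d−1} Σ_{∅≠J⊆{j+1,…,d}} (−1)^{|J|+1} β² j J`. -/
theorem stmt2 {Ω : Type*} [MeasurableSpace Ω] (P : Measure Ω) [IsProbabilityMeasure P]
    (d : ℕ) (hd : 2 ≤ d)
    (A : ℕ → ℕ → Set Ω) (B C : ℕ → ℕ → Set Ω)
    (hAmeas : ∀ n j, MeasurableSet (A n j))
    (hBmeas : ∀ n j, MeasurableSet (B n j)) (hCmeas : ∀ n j, MeasurableSet (C n j))
    (hCB : ∀ n, ∀ j ∈ Finset.Icc 1 (d - 1), C n j ⊆ B n j)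
    (hBA : ∀ n, ∀ j ∈ Finset.Icc 1 (d - 1), B n j ⊆ ⋂ i ∈ Finset.Icc j d, A n i)
    (hBpos : ∀ n, ∀ j ∈ Finset.Icc 1 (d - 1), 0 < (P (B n j)).toReal)
    (k : ℕ → ℝ) (hk : ∀ n, 0 < k n)
    (a : ℕ → ℝ) (c b β₁ : ℕ → ℝ) (β₂ : ℕ → Finset ℕ → ℝ)
    (ha : ∀ j ∈ Finset.Icc 1 d,
      Tendsto (fun n => k n * (P (A n j)).toReal) atTop (nhds (a j)))
    (hc : ∀ j ∈ Finset.Icc 1 (d - 1),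
      Tendsto (fun n => k n * (P (C n j)).toReal) atTop (nhds (c j)))
    (hb : ∀ j ∈ Finset.Icc 1 (d - 1),
      Tendsto (fun n => k n * (P (B n j)).toReal) atTop (nhds (b j)))
    (hβ₁ : ∀ j ∈ Finset.Icc 1 (d - 1),
      Tendsto (fun n => (P ((C n j)ᶜ ∩ B n j)).toReal / (P (B n j)).toReal)
        atTop (nhds (β₁ j)))
    (hB0 : ∀ j ∈ Finset.Icc 1 (d - 1),
      Tendsto (fun n => (P (B n j)).toReal) atTop (nhds 0))
    (hβ₂ : ∀ j ∈ Finset.Icc 1 (d - 1), ∀ J ⊆ Finset.Icc (j + 1) d, J.Nonempty →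
      Tendsto (fun n =>
        k n * ((P ((A n j ∩ ⋂ i ∈ J, A n i) ∩ (B n j)ᶜ)).toReal /
          (P ((B n j)ᶜ)).toReal)) atTop (nhds (β₂ j J))) :
    Tendsto (fun n => k n * (P (⋃ j ∈ Finset.Icc 1 d, A n j)).toReal) atTop
      (nhds (∑ j ∈ Finset.Icc 1 d, a j - ∑ j ∈ Finset.Icc 1 (d - 1), c j
        - ∑ j ∈ Finset.Icc 1 (d - 1), b j * β₁ j
        - ∑ j ∈ Finset.Icc 1 (d - 1),
            ∑ J ∈ (Finset.Icc (j + 1) d).powerset.filter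
                (fun J : Finset ℕ => J.Nonempty),
              (-1 : ℝ) ^ (J.card + 1) * β₂ j J)) := by
  simp only [← measureReal_def] at *
  have hterm : ∀ j ∈ Finset.Icc 1 (d - 1),
      Tendsto (fun n => k n * P.real (A n j ∩ ⋃ l ∈ Finset.Icc (j + 1) d, A n l)) atTop
        (nhds (c j + b j * β₁ j +
          ∑ J ∈ (Finset.Icc (j + 1) d).powerset.filter (fun J : Finset ℕ => J.Nonempty),
            (-1 : ℝ) ^ (J.card + 1) * β₂ j J)) := by
    intro j hj
    have hjd : 1 ≤ j ∧ j ≤ d - 1 := Finset.mem_Icc.mp hj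
    have hcompl : Tendsto (fun n => P.real (B n j)ᶜ) atTop (nhds 1) := by
      simpa [probReal_compl_eq_one_sub (hBmeas _ j)] using (hB0 j hj).const_sub 1
    have hJ : ∀ J ∈ (Finset.Icc (j + 1) d).powerset.filter (fun J : Finset ℕ => J.Nonempty),
        Tendsto (fun n => (-1 : ℝ) ^ (J.card + 1) *
          (k n * P.real ((A n j ∩ ⋂ i ∈ J, A n i) ∩ (B n j)ᶜ))) atTop
          (nhds ((-1 : ℝ) ^ (J.card + 1) * β₂ j J)) := by
      intro J hJ
      rw [Finset.mem_filter, Finset.mem_powerset] at hJ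
      have h := (hβ₂ j hj J hJ.1 hJ.2).mul hcompl
      rw [mul_one] at h
      refine (h.congr fun n => ?_).const_mul _
      rw [mul_assoc, div_mul_cancel_of_imp]
      exact fun h0 => measureReal_mono_null Set.inter_subset_right h0
    refine (((hc j hj).add ((hb j hj).mul (hβ₁ j hj))).add (tendsto_finsetSum _ hJ)).congr
      fun n => ?_
    have hBsub : B n j ⊆ A n j ∩ ⋃ l ∈ Finset.Icc (j + 1) d, A n l := by
      intro ω hω
      have hω' := Set.mem_iInter₂.mp (hBA n j hj hω)
      exact ⟨hω' j (Finset.mem_Icc.mpr (by omega)), Set.mem_iUnion₂.mpr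
        ⟨j + 1, Finset.mem_Icc.mpr (by omega), hω' (j + 1) (Finset.mem_Icc.mpr (by omega))⟩⟩
    have h1 := measureReal_inter_add_sdiff (μ := P)
      (s := A n j ∩ ⋃ l ∈ Finset.Icc (j + 1) d, A n l) (hBmeas n j)
    rw [Set.inter_eq_right.mpr hBsub, Set.sdiff_eq,
      measureReal_inter_biUnion_inter_eq_sum_powerset P (A n) (hAmeas n)] at h1
    have h2 := measureReal_inter_add_sdiff (μ := P) (s := B n j) (hCmeas n j)
    rw [Set.inter_eq_right.mpr (hCB n j hj), Set.sdiff_eq, Set.inter_comm] at h2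
    rw [← h1, mul_assoc, mul_div_cancel₀ _ (hBpos n j hj).ne', mul_add, Finset.mul_sum, ← mul_add,
      h2]
    simp only [mul_left_comm (k n)]
  have hlim := (tendsto_finsetSum _ ha).sub (tendsto_finsetSum _ hterm)
  simp only [Finset.sum_add_distrib, ← sub_sub] at hlim
  refine hlim.congr fun n => ?_
  have hlast : ∑ j ∈ Finset.Icc 1 (d - 1), P.real (A n j ∩ ⋃ l ∈ Finset.Icc (j + 1) d, A n l) =
      ∑ j ∈ Finset.Icc 1 d, P.real (A n j ∩ ⋃ l ∈ Finset.Icc (j + 1) d, A n l) := by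
    refine Finset.sum_subset (Finset.Icc_subset_Icc_right (Nat.sub_le d 1)) fun j hj hj' => ?_
    rw [Finset.mem_Icc] at hj hj'
    simp [Finset.Icc_eq_empty_of_lt (show d < j + 1 by omega)]
  rw [measureReal_biUnion_Icc_eq_sum_sub P (A n) (hAmeas n), Finset.sum_sub_distrib, ← hlast,
    mul_sub, Finset.mul_sum, Finset.mul_sum]
end

section
/- Let (Ω, 𝔄, P) be a probability space, d ≥ 2 an integer and D = {1,…,d}. For each n ∈ ℕ let A_{n,1},…,A_{n,d} be events and, for every permutation σ of D and each j ∈ {1,…,d−1}, let C^{σ}_{n,j} be an event with C^{σ}_{n,j} ⊆ ⋂_{i=j}^{d} A_{n,σ(i)}, and let (k_n) be a sequence of positive real numbers. Assume that, as n → ∞, k_n·P(A_{n,j}) → a_j for each j ∈ D and k_n·P(C^{σ}_{n,j}) → c^{σ}_j for each permutation σ and each j ≤ d−1. Then limsup_{n→∞} k_n·P(⋃_{j∈D} A_{n,j}) ≤ Σ_{j=1}^{d} a_j − max_{σ} Σ_{j=1}^{d−1} c^{σ}_j, where the maximum is over all permutations σ of D. -/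
open MeasureTheory Filter

/-- If each `C j` with `j` not the last index lies in all `B i` with `i ≥ j`, then the union of
the `B i` is covered by the last `B i` and the differences `B j \ C j`. -/
theorem measureReal_iUnion_le_sum_sub {Ω : Type*} [MeasurableSpace Ω] (P : Measure Ω)
    [IsFiniteMeasure P] {d : ℕ} (B C : Fin d → Set Ω) (hC : ∀ j, MeasurableSet (C j))
    (hCB : ∀ j : Fin d, (j : ℕ) + 1 < d → C j ⊆ ⋂ i ∈ Finset.Ici j, B i) :
    P.real (⋃ j, B j) ≤ ∑ j, P.real (B j) -
      ∑ j ∈ Finset.univ.filter (fun j : Fin d => (j : ℕ) + 1 < d), P.real (C j) := by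
  have hCB' (j : Fin d) (hj : (j : ℕ) + 1 < d) {i : Fin d} (hi : j ≤ i) : C j ⊆ B i :=
    fun ω hω => Set.mem_iInter₂.1 (hCB j hj hω) i (Finset.mem_Ici.2 hi)
  let E : Fin d → Set Ω := fun j => if (j : ℕ) + 1 < d then B j \ C j else B j
  have hcover : ⋃ j, B j ⊆ ⋃ j, E j := by
    refine Set.iUnion_subset fun j ω hω => Set.mem_iUnion.2 ?_
    by_cases hmem : (j : ℕ) + 1 < d ∧ ω ∈ C j
    · let l : Fin d := ⟨d - 1, by have := j.isLt; omega⟩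
      have hl : ¬ (l : ℕ) + 1 < d := by simp only [l]; omega
      refine ⟨l, ?_⟩
      simp only [E, if_neg hl]
      refine hCB' j hmem.1 ?_ hmem.2
      rw [Fin.le_def]
      simp only [l]
      omega
    · refine ⟨j, ?_⟩
      by_cases hj : (j : ℕ) + 1 < d
      · simp only [E, if_pos hj]
        exact ⟨hω, fun h => hmem ⟨hj, h⟩⟩
      · simpa only [E, if_neg hj] using hω
  calc P.real (⋃ j, B j) ≤ P.real (⋃ j, E j) := measureReal_mono hcover
    _ ≤ ∑ j, P.real (E j) := measureReal_iUnion_fintype_le _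
    _ = ∑ j, P.real (B j) -
        ∑ j ∈ Finset.univ.filter (fun j : Fin d => (j : ℕ) + 1 < d), P.real (C j) := by
      rw [Finset.sum_filter, ← Finset.sum_sub_distrib]
      refine Finset.sum_congr rfl fun j _ => ?_
      by_cases hj : (j : ℕ) + 1 < d
      · simp only [E, if_pos hj]
        exact measureReal_sdiff (hCB' j hj le_rfl) (hC j)
      · simp only [E, if_neg hj, sub_zero]

/-- Abstract form of the improved upper bound following (12): for every
permutation `σ` of the coordinates and each `j ∈ {1,…,d−1}` (here `0`-based,
`(j : ℕ) + 1 < d`), if `C n σ j ⊆ ⋂_{i ≥ j} A n (σ i)`, `k n * P (A n j) → a j` and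
`k n * P (C n σ j) → c σ j`, then
`limsup k n * P (⋃ j, A n j) ≤ Σ_j a j − max_σ Σ_{j} c σ j`. -/
theorem stmt4 {Ω : Type*} [MeasurableSpace Ω] (P : Measure Ω) [IsProbabilityMeasure P]
    (d : ℕ) (hd : 2 ≤ d)
    (A : ℕ → Fin d → Set Ω) (C : ℕ → Equiv.Perm (Fin d) → Fin d → Set Ω)
    (hAmeas : ∀ n j, MeasurableSet (A n j))
    (hCmeas : ∀ n σ j, MeasurableSet (C n σ j))
    (hCA : ∀ (n : ℕ) (σ : Equiv.Perm (Fin d)) (j : Fin d), (j : ℕ) + 1 < d →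
      C n σ j ⊆ ⋂ i ∈ Finset.Ici j, A n (σ i))
    (k : ℕ → ℝ) (hk : ∀ n, 0 < k n)
    (a : Fin d → ℝ) (c : Equiv.Perm (Fin d) → Fin d → ℝ)
    (ha : ∀ j : Fin d,
      Tendsto (fun n => k n * (P (A n j)).toReal) atTop (nhds (a j)))
    (hc : ∀ (σ : Equiv.Perm (Fin d)) (j : Fin d), (j : ℕ) + 1 < d →
      Tendsto (fun n => k n * (P (C n σ j)).toReal) atTop (nhds (c σ j))) :
    Filter.limsup (fun n => k n * (P (⋃ j, A n j)).toReal) atTop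
      ≤ ∑ j, a j -
        ⨆ σ : Equiv.Perm (Fin d),
          ∑ j ∈ Finset.univ.filter (fun j : Fin d => (j : ℕ) + 1 < d), c σ j := by
  rw [le_sub_comm]
  refine ciSup_le fun σ => ?_
  rw [le_sub_comm]
  have hlim : Tendsto (fun n => ∑ j, k n * P.real (A n j) -
      ∑ j ∈ Finset.univ.filter (fun j : Fin d => (j : ℕ) + 1 < d), k n * P.real (C n σ j))
      atTop (nhds (∑ j, a j -
        ∑ j ∈ Finset.univ.filter (fun j : Fin d => (j : ℕ) + 1 < d), c σ j)) :=
    (tendsto_finsetSum _ fun j _ => ha j).sub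
      (tendsto_finsetSum _ fun j hj => hc σ j (Finset.mem_filter.1 hj).2)
  rw [← hlim.limsup_eq]
  refine limsup_le_limsup (Eventually.of_forall fun n => ?_) ?_ hlim.isBoundedUnder_le
  · have hbound := measureReal_iUnion_le_sum_sub P (fun j => A n (σ j)) (C n σ) (hCmeas n σ)
      (hCA n σ)
    rw [σ.surjective.iUnion_comp (A n), Equiv.sum_comp σ fun j => P.real (A n j)] at hbound
    simpa only [mul_sub, Finset.mul_sum, measureReal_def] using mul_le_mul_of_nonneg_left hbound (hk n).le
  · exact IsCoboundedUnder.of_frequently_ge (a := 0)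
      (Frequently.of_forall fun n => mul_nonneg (hk n).le ENNReal.toReal_nonneg)
end

section
/- For every real number ε ∈ [1,2), one has lim_{u→1⁻} [2·log(1 − u) / log(1 − 2u + u^ε)] − 1 = 1 (the quantity 1 − 2u + u^ε is strictly positive for u ∈ (0,1)). -/
open Real Filter

/-- If `g → 0⁺` and `f / g` has a nonzero limit, then `log f` and `log g` are asymptotically
equivalent. -/
theorem tendsto_log_div_log_of_tendsto_div {α : Type*} {l : Filter α} {f g : α → ℝ} {c : ℝ}
    (hc : c ≠ 0) (hg : Tendsto g l (nhdsWithin 0 (Set.Ioi 0)))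
    (hfg : Tendsto (fun x => f x / g x) l (nhds c)) :
    Tendsto (fun x => Real.log (f x) / Real.log (g x)) l (nhds 1) := by
  have hlog : Tendsto (fun x => Real.log (g x)) l atBot := Real.tendsto_log_nhdsGT_zero.comp hg
  have hquot : Tendsto (fun x => Real.log (f x / g x) / Real.log (g x)) l (nhds 0) :=
    (hfg.log hc).div_atBot hlog
  have hadd := hquot.add_const 1
  rw [zero_add] at hadd
  refine hadd.congr' ?_
  filter_upwards [hfg.eventually_ne hc, hlog.eventually_ne_atBot 0] with x hx hgx
  obtain ⟨hf, hg⟩ := div_ne_zero_iff.mp hx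
  rw [Real.log_div hf hg]
  field_simp
  ring

/-- The function `1 - 2u + u^ε` vanishes at `1` with derivative `ε - 2`. -/
theorem tendsto_one_sub_two_mul_add_rpow_div (ε : ℝ) :
    Tendsto (fun u : ℝ => (1 - 2 * u + u ^ ε) / (1 - u)) (nhdsWithin 1 (Set.Iio 1))
      (nhds (2 - ε)) := by
  have hderiv : HasDerivAt (fun u : ℝ => 1 - 2 * u + u ^ ε) (ε - 2) 1 := by
    have h := (((hasDerivAt_id (1 : ℝ)).const_mul 2).const_sub 1).add
      (Real.hasDerivAt_rpow_const (x := 1) (p := ε) (Or.inl one_ne_zero))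
    refine h.congr_deriv ?_
    rw [Real.one_rpow]
    ring
  have hslope := (hderiv.tendsto_slope.mono_left
    (nhdsWithin_mono 1 fun u (hu : u < 1) => hu.ne)).neg
  rw [neg_sub] at hslope
  refine hslope.congr fun u => ?_
  rw [slope_def_field, Real.one_rpow, ← div_neg, neg_sub]
  ring

/-- For `ε ∈ [1,2)`,
`2 log(1 − u) / log(1 − 2u + u^ε) − 1 → 1` as `u → 1⁻`. -/
theorem stmt6 (ε : ℝ) (hε : ε ∈ Set.Ico (1 : ℝ) 2) :
    Tendsto (fun u : ℝ =>
        2 * Real.log (1 - u) / Real.log (1 - 2 * u + u ^ ε) - 1)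
      (nhdsWithin 1 (Set.Iio 1)) (nhds 1) := by
  have hone_sub : Tendsto (fun u : ℝ => 1 - u) (nhdsWithin 1 (Set.Iio 1))
      (nhdsWithin 0 (Set.Ioi 0)) := by
    refine tendsto_nhdsWithin_iff.mpr ⟨?_, ?_⟩
    · have h : Tendsto (fun u : ℝ => 1 - u) (nhds 1) (nhds (1 - 1)) :=
        (continuous_const.sub continuous_id).tendsto 1
      rw [sub_self] at h
      exact h.mono_left nhdsWithin_le_nhds
    · filter_upwards [self_mem_nhdsWithin] with u hu
      exact sub_pos.mpr (Set.mem_Iio.mp hu)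
  have hratio := tendsto_log_div_log_of_tendsto_div (sub_pos.mpr hε.2).ne' hone_sub
    (tendsto_one_sub_two_mul_add_rpow_div ε)
  have hlim := ((hratio.inv₀ one_ne_zero).const_mul 2).sub_const 1
  norm_num only at hlim
  refine hlim.congr fun u => ?_
  rw [inv_div, mul_div_assoc]
end

section
/- Let ℓ : (0,∞)² → (0,∞) satisfy ℓ(tx, ty) = ℓ(x,y)/t for all t, x, y > 0, let θ : (0,∞)² → (0,1] satisfy θ(tτ₁, tτ₂) = θ(τ₁, τ₂) for all t, τ₁, τ₂ > 0, and let θ₁, θ₂ ∈ (0,1]. Define H(x,y) = exp(−θ(1/x, 1/y)·ℓ(x,y)) for x, y > 0 and Γ(τ₁, τ₂) = ℓ(1/τ₁, 1/τ₂). Then for every u ∈ (0,1), H(−θ₁/log u, −θ₂/log u) = u^{θ(1/θ₁, 1/θ₂)·Γ(1/θ₁, 1/θ₂)}; consequently lim_{u→1⁻} log H(−θ₁/log u, −θ₂/log u) / log u = θ(1/θ₁, 1/θ₂)·Γ(1/θ₁, 1/θ₂), i.e. the upper tail dependence coefficient of H equals χ^H = 2 − θ(1/θ₁, 1/θ₂)·Γ(1/θ₁,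 1/θ₂). -/
open Real Filter

/-- Proposition 4(a). With `ℓ` homogeneous of order `−1`, `θ`
homogeneous of order `0` with values in `(0,1]`, `θ₁, θ₂ ∈ (0,1]`,
`H x y = exp (−θ(1/x,1/y) ℓ(x,y))` and `Γ(τ₁,τ₂) = ℓ(1/τ₁,1/τ₂)`, one has
`H(−θ₁/log u, −θ₂/log u) = u^{θ(1/θ₁,1/θ₂) Γ(1/θ₁,1/θ₂)}` for `u ∈ (0,1)`, hence the
upper tail dependence coefficient `χ^H = 2 − lim_{u→1⁻} log H(…)/log u`
equals `2 − θ(1/θ₁,1/θ₂) Γ(1/θ₁,1/θ₂)`. -/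
theorem stmt7 (ℓ : ℝ → ℝ → ℝ) (θ : ℝ → ℝ → ℝ) (θ₁ θ₂ : ℝ)
    (hℓpos : ∀ x y : ℝ, 0 < x → 0 < y → 0 < ℓ x y)
    (hℓhom : ∀ t x y : ℝ, 0 < t → 0 < x → 0 < y → ℓ (t * x) (t * y) = ℓ x y / t)
    (hθmem : ∀ τ₁ τ₂ : ℝ, 0 < τ₁ → 0 < τ₂ → θ τ₁ τ₂ ∈ Set.Ioc (0 : ℝ) 1)
    (hθhom : ∀ t τ₁ τ₂ : ℝ, 0 < t → 0 < τ₁ → 0 < τ₂ → θ (t * τ₁) (t * τ₂) = θ τ₁ τ₂)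
    (hθ₁ : θ₁ ∈ Set.Ioc (0 : ℝ) 1) (hθ₂ : θ₂ ∈ Set.Ioc (0 : ℝ) 1)
    (H : ℝ → ℝ → ℝ)
    (hH : ∀ x y : ℝ, 0 < x → 0 < y →
      H x y = Real.exp (-(θ (1 / x) (1 / y) * ℓ x y)))
    (Γ : ℝ → ℝ → ℝ) (hΓ : ∀ τ₁ τ₂ : ℝ, Γ τ₁ τ₂ = ℓ (1 / τ₁) (1 / τ₂)) :
    (∀ u ∈ Set.Ioo (0 : ℝ) 1,
      H (-θ₁ / Real.log u) (-θ₂ / Real.log u)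
        = u ^ (θ (1 / θ₁) (1 / θ₂) * Γ (1 / θ₁) (1 / θ₂))) ∧
    Tendsto (fun u : ℝ =>
        Real.log (H (-θ₁ / Real.log u) (-θ₂ / Real.log u)) / Real.log u)
      (nhdsWithin 1 (Set.Iio 1))
      (nhds (θ (1 / θ₁) (1 / θ₂) * Γ (1 / θ₁) (1 / θ₂))) ∧
    Tendsto (fun u : ℝ =>
        2 - Real.log (H (-θ₁ / Real.log u) (-θ₂ / Real.log u)) / Real.log u)
      (nhdsWithin 1 (Set.Iio 1))
      (nhds (2 - θ (1 / θ₁) (1 / θ₂) * Γ (1 / θ₁) (1 / θ₂))) := by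
  obtain ⟨hθ₁pos, -⟩ := hθ₁
  obtain ⟨hθ₂pos, -⟩ := hθ₂
  have hdiag : ∀ u ∈ Set.Ioo (0 : ℝ) 1,
      H (-θ₁ / Real.log u) (-θ₂ / Real.log u)
        = u ^ (θ (1 / θ₁) (1 / θ₂) * Γ (1 / θ₁) (1 / θ₂)) := by
    intro u hu
    have hs : 0 < -Real.log u := neg_pos.2 (Real.log_neg hu.1 hu.2)
    have harg (a : ℝ) : -a / Real.log u = (-Real.log u)⁻¹ * a := by
      rw [inv_neg, div_eq_inv_mul, mul_neg, neg_mul]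
    have hinv (a : ℝ) : 1 / ((-Real.log u)⁻¹ * a) = -Real.log u * (1 / a) := by
      rw [one_div, mul_inv, inv_inv, one_div]
    rw [harg, harg, hH _ _ (mul_pos (inv_pos.2 hs) hθ₁pos) (mul_pos (inv_pos.2 hs) hθ₂pos),
      hinv, hinv, hθhom _ _ _ hs (one_div_pos.2 hθ₁pos) (one_div_pos.2 hθ₂pos),
      hℓhom _ _ _ (inv_pos.2 hs) hθ₁pos hθ₂pos, hΓ, one_div_one_div, one_div_one_div,
      Real.rpow_def_of_pos hu.1, div_inv_eq_mul]
    ring_nf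
  have hlim : Tendsto (fun u : ℝ =>
        Real.log (H (-θ₁ / Real.log u) (-θ₂ / Real.log u)) / Real.log u)
      (nhdsWithin 1 (Set.Iio 1))
      (nhds (θ (1 / θ₁) (1 / θ₂) * Γ (1 / θ₁) (1 / θ₂))) := by
    refine tendsto_const_nhds.congr' ?_
    filter_upwards [Ioo_mem_nhdsLT (zero_lt_one' ℝ)] with u hu
    rw [hdiag u hu, Real.log_rpow hu.1, mul_div_cancel_right₀ _ (Real.log_neg hu.1 hu.2).ne]
  exact ⟨hdiag, hlim, hlim.const_sub 2⟩
end

section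
/- Let ℓ : (0,∞)² → (0,∞) satisfy ℓ(tx, ty) = ℓ(x,y)/t for all t, x, y > 0, let θ : (0,∞)² → (0,1] satisfy θ(tτ₁, tτ₂) = θ(τ₁, τ₂) for all t, τ₁, τ₂ > 0, and let θ₁, θ₂ ∈ (0,1]. Define Ĥ(x,y) = exp(−ℓ(x,y)), H(x,y) = exp(−θ(1/x, 1/y)·ℓ(x,y)) and Γ(τ₁, τ₂) = ℓ(1/τ₁, 1/τ₂). Then, with χ^H = 2 − lim_{u→1⁻} log H(−θ₁/log u, −θ₂/log u)/log u and χ^Ĥ = 2 − lim_{u→1⁻} log Ĥ(−1/log u, −1/log u)/log u, both limits exist and χ^H − χ^Ĥ = Γ(1,1) − θ(1/θ₁, 1/θ₂)·Γ(1/θ₁, 1/θ₂). -/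
open Real Filter

/-- If `F = exp (-f)` with `f` homogeneous of order `-1`, then `log F / log u` along the ray
`(-a / log u, -b / log u)` is constant in `u ∈ (0, 1)`, equal to `f a b`. -/
theorem tendsto_log_div_log_of_homogeneous {f F : ℝ → ℝ → ℝ} {a b : ℝ}
    (hf : ∀ t x y : ℝ, 0 < t → 0 < x → 0 < y → f (t * x) (t * y) = f x y / t)
    (hF : ∀ x y : ℝ, 0 < x → 0 < y → F x y = Real.exp (-f x y))
    (ha : 0 < a) (hb : 0 < b) :
    Tendsto (fun u : ℝ => Real.log (F (-a / Real.log u) (-b / Real.log u)) / Real.log u)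
      (nhdsWithin 1 (Set.Iio 1)) (nhds (f a b)) := by
  refine tendsto_const_nhds.congr' ?_
  filter_upwards [Ioo_mem_nhdsLT (zero_lt_one' ℝ)] with u hu
  have hlog : Real.log u < 0 := Real.log_neg hu.1 hu.2
  have ht : 0 < -(Real.log u)⁻¹ := neg_pos.2 (inv_lt_zero.2 hlog)
  have hray (c : ℝ) : -c / Real.log u = -(Real.log u)⁻¹ * c := by ring
  rw [hray, hray, hF _ _ (mul_pos ht ha) (mul_pos ht hb), Real.log_exp, hf _ _ _ ht ha hb]
  field_simp [hlog.ne]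

/-- Proposition 4(b). With `ℓ` homogeneous of order `−1`, `θ`
homogeneous of order `0` with values in `(0,1]`, `θ₁, θ₂ ∈ (0,1]`,
`Ĥ = exp (−ℓ)`, `H = exp (−θ(1/x,1/y) ℓ(x,y))` and `Γ(τ₁,τ₂) = ℓ(1/τ₁,1/τ₂)`, the limits
defining `χ^H = 2 − lim_{u→1⁻} log H(−θ₁/log u, −θ₂/log u)/log u` and
`χ^Ĥ = 2 − lim_{u→1⁻} log Ĥ(−1/log u, −1/log u)/log u` exist and
`χ^H − χ^Ĥ = Γ(1,1) − θ(1/θ₁,1/θ₂) Γ(1/θ₁,1/θ₂)`. -/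
theorem stmt8 (ℓ : ℝ → ℝ → ℝ) (θ : ℝ → ℝ → ℝ) (θ₁ θ₂ : ℝ)
    (hℓpos : ∀ x y : ℝ, 0 < x → 0 < y → 0 < ℓ x y)
    (hℓhom : ∀ t x y : ℝ, 0 < t → 0 < x → 0 < y → ℓ (t * x) (t * y) = ℓ x y / t)
    (hθmem : ∀ τ₁ τ₂ : ℝ, 0 < τ₁ → 0 < τ₂ → θ τ₁ τ₂ ∈ Set.Ioc (0 : ℝ) 1)
    (hθhom : ∀ t τ₁ τ₂ : ℝ, 0 < t → 0 < τ₁ → 0 < τ₂ → θ (t * τ₁) (t * τ₂) = θ τ₁ τ₂)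
    (hθ₁ : θ₁ ∈ Set.Ioc (0 : ℝ) 1) (hθ₂ : θ₂ ∈ Set.Ioc (0 : ℝ) 1)
    (Hhat H : ℝ → ℝ → ℝ)
    (hHhat : ∀ x y : ℝ, 0 < x → 0 < y → Hhat x y = Real.exp (-ℓ x y))
    (hH : ∀ x y : ℝ, 0 < x → 0 < y →
      H x y = Real.exp (-(θ (1 / x) (1 / y) * ℓ x y)))
    (Γ : ℝ → ℝ → ℝ) (hΓ : ∀ τ₁ τ₂ : ℝ, Γ τ₁ τ₂ = ℓ (1 / τ₁) (1 / τ₂)) :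
    ∃ LH LHhat : ℝ,
      Tendsto (fun u : ℝ =>
          Real.log (H (-θ₁ / Real.log u) (-θ₂ / Real.log u)) / Real.log u)
        (nhdsWithin 1 (Set.Iio 1)) (nhds LH) ∧
      Tendsto (fun u : ℝ =>
          Real.log (Hhat (-1 / Real.log u) (-1 / Real.log u)) / Real.log u)
        (nhdsWithin 1 (Set.Iio 1)) (nhds LHhat) ∧
      (2 - LH) - (2 - LHhat)
        = Γ 1 1 - θ (1 / θ₁) (1 / θ₂) * Γ (1 / θ₁) (1 / θ₂) := by
  refine ⟨θ (1 / θ₁) (1 / θ₂) * ℓ θ₁ θ₂, ℓ 1 1, ?_,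
    tendsto_log_div_log_of_homogeneous hℓhom hHhat one_pos one_pos, ?_⟩
  · refine tendsto_log_div_log_of_homogeneous
      (f := fun x y => θ (1 / x) (1 / y) * ℓ x y) ?_ hH hθ₁.1 hθ₂.1
    intro t x y ht hx hy
    have hinv (z : ℝ) : 1 / (t * z) = t⁻¹ * (1 / z) := by
      rw [one_div, mul_inv, one_div]
    rw [hℓhom t x y ht hx hy, hinv, hinv,
      hθhom _ _ _ (inv_pos.2 ht) (one_div_pos.2 hx) (one_div_pos.2 hy), mul_div_assoc]
  · simp only [hΓ, one_div_one_div, one_div_one]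
    ring
end

section
/- Let ℓ : (0,∞)² → (0,∞) satisfy ℓ(tx, ty) = ℓ(x,y)/t for all t, x, y > 0, and let θ₀ ∈ (0,1]. Define Ĥ(x,y) = exp(−ℓ(x,y)) and H(x,y) = exp(−θ₀·ℓ(x,y)). Then θ₀·ℓ(θ₀, θ₀) = ℓ(1,1), and consequently the upper tail dependence coefficients coincide: 2 − lim_{u→1⁻} log H(−θ₀/log u, −θ₀/log u)/log u = 2 − lim_{u→1⁻} log Ĥ(−1/log u, −1/log u)/log u, i.e. χ^H = χ^Ĥ = 2 − ℓ(1,1). -/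
open Real Filter

/-- Along the diagonal point `-c / log u`, a function `exp (-(c * ℓ))` with `ℓ` behaving like
`a / s` on the diagonal has constant logarithmic ratio `a`. -/
theorem tendsto_log_div_log_of_diagonal {F ℓ : ℝ → ℝ → ℝ} {a c : ℝ} (hc : 0 < c)
    (hdiag : ∀ s : ℝ, 0 < s → ℓ s s = a / s)
    (hF : ∀ x y : ℝ, 0 < x → 0 < y → F x y = Real.exp (-(c * ℓ x y))) :
    Tendsto (fun u : ℝ => Real.log (F (-c / Real.log u) (-c / Real.log u)) / Real.log u)
      (nhdsWithin 1 (Set.Iio 1)) (nhds a) := by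
  refine tendsto_const_nhds.congr' ?_
  filter_upwards [Ioo_mem_nhdsLT (zero_lt_one' ℝ)] with u hu
  have hlog : Real.log u < 0 := Real.log_neg hu.1 hu.2
  have hs : 0 < -c / Real.log u := div_pos_of_neg_of_neg (neg_neg_of_pos hc) hlog
  rw [hF _ _ hs hs, Real.log_exp, hdiag _ hs]
  have hlog' := hlog.ne
  have hc' := hc.ne'
  field_simp

/-- Corollary, part (a). With `ℓ` homogeneous of order `−1`,
`θ₀ ∈ (0,1]`, `Ĥ = exp (−ℓ)` and `H = exp (−θ₀ ℓ)`, one has `θ₀ ℓ(θ₀,θ₀) = ℓ(1,1)`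
and the upper tail dependence coefficients coincide:
both `log H(−θ₀/log u, −θ₀/log u)/log u` and `log Ĥ(−1/log u, −1/log u)/log u`
tend to `ℓ(1,1)` as `u → 1⁻`, i.e. `χ^H = χ^Ĥ = 2 − ℓ(1,1)`. -/
theorem stmt9 (ℓ : ℝ → ℝ → ℝ) (θ₀ : ℝ)
    (hℓpos : ∀ x y : ℝ, 0 < x → 0 < y → 0 < ℓ x y)
    (hℓhom : ∀ t x y : ℝ, 0 < t → 0 < x → 0 < y → ℓ (t * x) (t * y) = ℓ x y / t)
    (hθ₀ : θ₀ ∈ Set.Ioc (0 : ℝ) 1)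
    (Hhat H : ℝ → ℝ → ℝ)
    (hHhat : ∀ x y : ℝ, 0 < x → 0 < y → Hhat x y = Real.exp (-ℓ x y))
    (hH : ∀ x y : ℝ, 0 < x → 0 < y → H x y = Real.exp (-(θ₀ * ℓ x y))) :
    θ₀ * ℓ θ₀ θ₀ = ℓ 1 1 ∧
    Tendsto (fun u : ℝ =>
        Real.log (H (-θ₀ / Real.log u) (-θ₀ / Real.log u)) / Real.log u)
      (nhdsWithin 1 (Set.Iio 1)) (nhds (ℓ 1 1)) ∧
    Tendsto (fun u : ℝ =>
        Real.log (Hhat (-1 / Real.log u) (-1 / Real.log u)) / Real.log u)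
      (nhdsWithin 1 (Set.Iio 1)) (nhds (ℓ 1 1)) := by
  have hdiag : ∀ s : ℝ, 0 < s → ℓ s s = ℓ 1 1 / s := fun s hs => by
    simpa using hℓhom s 1 1 hs one_pos one_pos
  refine ⟨?_, tendsto_log_div_log_of_diagonal hθ₀.1 hdiag hH,
    tendsto_log_div_log_of_diagonal one_pos hdiag (by simpa using hHhat)⟩
  rw [hdiag θ₀ hθ₀.1, mul_div_cancel₀ _ hθ₀.1.ne']
end

section
/- Let θ : (0,∞)² → (0,1] satisfy θ(tτ₁, tτ₂) = θ(τ₁, τ₂) for all t, τ₁, τ₂ > 0, and let θ₁, θ₂ ∈ (0,1]. Define H(x,y) = exp(−θ(1/x, 1/y)·(1/x + 1/y)) for x, y > 0. Then for every u ∈ (0,1), H(−θ₁/log u, −θ₂/log u) = u^{θ(1/θ₁, 1/θ₂)·(1/θ₁ + 1/θ₂)}, and consequently the upper tail dependence coefficient of H equals χ^H = 2 − (1/θ₁ + 1/θ₂)·θ(1/θ₁, 1/θ₂). -/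
open Real Filter

/-- second Corollary, part (a): independent marginals of `Ĥ`.
With `θ` homogeneous of order `0` with values in `(0,1]`, `θ₁, θ₂ ∈ (0,1]` and
`H x y = exp (−θ(1/x,1/y)(1/x + 1/y))`, one has
`H(−θ₁/log u, −θ₂/log u) = u^{θ(1/θ₁,1/θ₂)(1/θ₁ + 1/θ₂)}` for `u ∈ (0,1)`, hence
`χ^H = 2 − (1/θ₁ + 1/θ₂) θ(1/θ₁,1/θ₂)`. -/
theorem stmt11 (θ : ℝ → ℝ → ℝ) (θ₁ θ₂ : ℝ)
    (hθmem : ∀ τ₁ τ₂ : ℝ, 0 < τ₁ → 0 < τ₂ → θ τ₁ τ₂ ∈ Set.Ioc (0 : ℝ) 1)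
    (hθhom : ∀ t τ₁ τ₂ : ℝ, 0 < t → 0 < τ₁ → 0 < τ₂ → θ (t * τ₁) (t * τ₂) = θ τ₁ τ₂)
    (hθ₁ : θ₁ ∈ Set.Ioc (0 : ℝ) 1) (hθ₂ : θ₂ ∈ Set.Ioc (0 : ℝ) 1)
    (H : ℝ → ℝ → ℝ)
    (hH : ∀ x y : ℝ, 0 < x → 0 < y →
      H x y = Real.exp (-(θ (1 / x) (1 / y) * (1 / x + 1 / y)))) :
    (∀ u ∈ Set.Ioo (0 : ℝ) 1,
      H (-θ₁ / Real.log u) (-θ₂ / Real.log u)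
        = u ^ (θ (1 / θ₁) (1 / θ₂) * (1 / θ₁ + 1 / θ₂))) ∧
    Tendsto (fun u : ℝ =>
        2 - Real.log (H (-θ₁ / Real.log u) (-θ₂ / Real.log u)) / Real.log u)
      (nhdsWithin 1 (Set.Iio 1))
      (nhds (2 - (1 / θ₁ + 1 / θ₂) * θ (1 / θ₁) (1 / θ₂))) := by
  have key : ∀ u ∈ Set.Ioo (0 : ℝ) 1,
      H (-θ₁ / Real.log u) (-θ₂ / Real.log u)
        = u ^ (θ (1 / θ₁) (1 / θ₂) * (1 / θ₁ + 1 / θ₂)) := by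
    intro u hu
    have hlog : Real.log u < 0 := Real.log_neg hu.1 hu.2
    have h₁ : 1 / (-θ₁ / Real.log u) = -Real.log u * (1 / θ₁) := by
      rw [one_div_div, div_neg]
      ring
    have h₂ : 1 / (-θ₂ / Real.log u) = -Real.log u * (1 / θ₂) := by
      rw [one_div_div, div_neg]
      ring
    rw [hH _ _ (div_pos_of_neg_of_neg (neg_neg_of_pos hθ₁.1) hlog)
        (div_pos_of_neg_of_neg (neg_neg_of_pos hθ₂.1) hlog), h₁, h₂,
      hθhom _ _ _ (neg_pos.mpr hlog) (one_div_pos.mpr hθ₁.1) (one_div_pos.mpr hθ₂.1),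
      Real.rpow_def_of_pos hu.1]
    congr 1
    ring
  refine ⟨key, tendsto_const_nhds.congr' ?_⟩
  filter_upwards [Ioo_mem_nhdsLT (zero_lt_one' ℝ)] with u hu
  rw [key u hu, Real.log_rpow hu.1, mul_div_cancel_right₀ _ (Real.log_neg hu.1 hu.2).ne,
    mul_comm]
end

section
/- Let θ : (0,∞)² → (0,1] satisfy θ(tτ₁, tτ₂) = θ(τ₁, τ₂) for all t, τ₁, τ₂ > 0, and let θ₁, θ₂ ∈ (0,1]. Define H(x,y) = exp(−θ(1/x, 1/y)·max(1/x, 1/y)) for x, y > 0. Then for every u ∈ (0,1), H(−θ₁/log u, −θ₂/log u) = u^{θ(1/θ₁, 1/θ₂)·max(1/θ₁, 1/θ₂)}, and consequently the upper tail dependence coefficient of H equals χ^H = 2 − max(1/θ₁, 1/θ₂)·θ(1/θ₁, 1/θ₂). -/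
open Real Filter

/-- second Corollary, part (b): totally dependent marginals of `Ĥ`.
With `θ` homogeneous of order `0` with values in `(0,1]`, `θ₁, θ₂ ∈ (0,1]` and
`H x y = exp (−θ(1/x,1/y)·max(1/x, 1/y))`, one has
`H(−θ₁/log u, −θ₂/log u) = u^{θ(1/θ₁,1/θ₂)·max(1/θ₁, 1/θ₂)}` for `u ∈ (0,1)`, hence
`χ^H = 2 − max(1/θ₁, 1/θ₂) θ(1/θ₁,1/θ₂)`. -/
theorem stmt12 (θ : ℝ → ℝ → ℝ) (θ₁ θ₂ : ℝ)
    (hθmem : ∀ τ₁ τ₂ : ℝ, 0 < τ₁ → 0 < τ₂ → θ τ₁ τ₂ ∈ Set.Ioc (0 : ℝ) 1)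
    (hθhom : ∀ t τ₁ τ₂ : ℝ, 0 < t → 0 < τ₁ → 0 < τ₂ → θ (t * τ₁) (t * τ₂) = θ τ₁ τ₂)
    (hθ₁ : θ₁ ∈ Set.Ioc (0 : ℝ) 1) (hθ₂ : θ₂ ∈ Set.Ioc (0 : ℝ) 1)
    (H : ℝ → ℝ → ℝ)
    (hH : ∀ x y : ℝ, 0 < x → 0 < y →
      H x y = Real.exp (-(θ (1 / x) (1 / y) * max (1 / x) (1 / y)))) :
    (∀ u ∈ Set.Ioo (0 : ℝ) 1,
      H (-θ₁ / Real.log u) (-θ₂ / Real.log u)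
        = u ^ (θ (1 / θ₁) (1 / θ₂) * max (1 / θ₁) (1 / θ₂))) ∧
    Tendsto (fun u : ℝ =>
        2 - Real.log (H (-θ₁ / Real.log u) (-θ₂ / Real.log u)) / Real.log u)
      (nhdsWithin 1 (Set.Iio 1))
      (nhds (2 - max (1 / θ₁) (1 / θ₂) * θ (1 / θ₁) (1 / θ₂))) := by
  have key : ∀ u ∈ Set.Ioo (0 : ℝ) 1,
      H (-θ₁ / Real.log u) (-θ₂ / Real.log u)
        = u ^ (θ (1 / θ₁) (1 / θ₂) * max (1 / θ₁) (1 / θ₂)) := by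
    rintro u ⟨hu0, hu1⟩
    have hlog : Real.log u < 0 := Real.log_neg hu0 hu1
    have hscale (a : ℝ) : 1 / (-a / Real.log u) = -Real.log u * (1 / a) := by
      rw [one_div_div, div_neg, mul_one_div, neg_div]
    rw [hH _ _ (div_pos_of_neg_of_neg (neg_lt_zero.2 hθ₁.1) hlog)
        (div_pos_of_neg_of_neg (neg_lt_zero.2 hθ₂.1) hlog), hscale, hscale,
      hθhom _ _ _ (neg_pos.2 hlog) (one_div_pos.2 hθ₁.1) (one_div_pos.2 hθ₂.1),
      ← mul_max_of_nonneg _ _ (neg_pos.2 hlog).le, Real.rpow_def_of_pos hu0]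
    ring_nf
  refine ⟨key, tendsto_const_nhds.congr' ?_⟩
  filter_upwards [Ioo_mem_nhdsLT (zero_lt_one (α := ℝ))] with u hu
  rw [key u hu, Real.log_rpow hu.1, mul_div_cancel_right₀ _ (Real.log_neg hu.1 hu.2).ne, mul_comm]
end
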